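/- Let L be a factorial and almost prolongable language over a finite alphabet with unbounded complexity, and suppose there exists N₀ such that for all n ≥ N₀ every word of length n in L is left-prolongable or right-prolongable (i.e., e(n) = 0 for n ≥ N₀). Suppose there exist reals α ∈ [0, 1/2] and β ∈ [1, 3/2] such that p(n) = O(n^β) and both e_l(n) = O(n^α) and e_r(n) = O(n^α). Then |p(n+1) − p(n)| = O(n^{3·max(α, β−1)}). -/

import Mathlib

open Filter Topology

variable {A : Type*}

/-- The set of words of `L` of length `n`. -/
def Ln (L : Set (List A)) (n : ℕ) : Set (List A) := {w | w ∈ L ∧ w.length = n}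

/-- The complexity function `p n = |L_n|`. -/
noncomputable def cplx (L : Set (List A)) (n : ℕ) : ℕ := Nat.card (Ln L n)

/-- A language is factorial if it is closed under taking contiguous subwords. -/
def IsFactorial (L : Set (List A)) : Prop := ∀ u v : List A, u ∈ L → v <:+: u → v ∈ L

/-- `w` is left-prolongable in `L`. -/
def LeftProlongable (L : Set (List A)) (w : List A) : Prop := ∃ a : A, (a :: w) ∈ L

/-- `w` is right-prolongable in `L`. -/
def RightProlongable (L : Set (List A)) (w : List A) : Prop := ∃ b : A, (w ++ [b]) ∈ L

/-- `e_l(n)`: the number of words of length `n` in `L` that are not left-prolongable. -/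
noncomputable def eL (L : Set (List A)) (n : ℕ) : ℕ :=
  Nat.card {w : List A | w ∈ Ln L n ∧ ¬ LeftProlongable L w}

/-- `e_r(n)`: the number of words of length `n` in `L` that are not right-prolongable. -/
noncomputable def eR (L : Set (List A)) (n : ℕ) : ℕ :=
  Nat.card {w : List A | w ∈ Ln L n ∧ ¬ RightProlongable L w}

/-- `L` is almost prolongable: `e_l(n)/p(n) → 0` and `e_r(n)/p(n) → 0`. -/
def AlmostProlongable (L : Set (List A)) : Prop :=
  Tendsto (fun n => (eL L n : ℝ) / (cplx L n : ℝ)) atTop (𝓝 0) ∧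
  Tendsto (fun n => (eR L n : ℝ) / (cplx L n : ℝ)) atTop (𝓝 0)

/-- `e(n)`: the number of words of length `n` in `L` that are neither left- nor
right-prolongable. -/
noncomputable def eBoth (L : Set (List A)) (n : ℕ) : ℕ :=
  Nat.card {w : List A | w ∈ Ln L n ∧ ¬ LeftProlongable L w ∧ ¬ RightProlongable L w}

section Counting

/-- If each fibre of `f : S → T` over `B` has at least two elements and each fibre over `T \ D` is
nonempty, then `|T| + |B| ≤ |S| + |D|`. -/
theorem ncard_add_le_of_fibers {X Y : Type*} {S : Set X} {T B D : Set Y} (hS : S.Finite)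
    (hT : T.Finite) (f : X → Y) (hf : Set.MapsTo f S T) (hB : B ⊆ T)
    (hB2 : ∀ t ∈ B, ∃ x ∈ S, ∃ y ∈ S, x ≠ y ∧ f x = t ∧ f y = t)
    (hD : D ⊆ T) (hD1 : ∀ t ∈ T, t ∉ D → ∃ x ∈ S, f x = t) :
    T.ncard + B.ncard ≤ S.ncard + D.ncard := by
  classical
  lift S to Finset X using hS
  lift T to Finset Y using hT
  lift B to Finset Y using T.finite_toSet.subset hB
  lift D to Finset Y using T.finite_toSet.subset hD
  simp only [Set.ncard_coe_finset]
  have hcard (Z : Finset Y) (hZ : (Z : Set Y) ⊆ T) :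
      Z.card = ∑ t ∈ T, if t ∈ Z then 1 else 0 := by
    rw [Finset.sum_ite_mem, Finset.inter_eq_right.2 (by exact_mod_cast hZ)]
    simp
  rw [Finset.card_eq_sum_card_fiberwise hf, hcard B hB, hcard D hD, Finset.card_eq_sum_ones,
    ← Finset.sum_add_distrib, ← Finset.sum_add_distrib]
  refine Finset.sum_le_sum fun t ht => ?_
  have h1 : t ∉ D → 1 ≤ (S.filter fun x => f x = t).card := fun h => by
    obtain ⟨x, hx, hxt⟩ := hD1 t ht h
    exact Finset.card_pos.2 ⟨x, by simpa using ⟨hx, hxt⟩⟩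
  have h2 : t ∈ B → 2 ≤ (S.filter fun x => f x = t).card := fun h => by
    obtain ⟨x, hx, y, hy, hxy, hxt, hyt⟩ := hB2 t h
    exact Finset.one_lt_card.2 ⟨x, by simpa using ⟨hx, hxt⟩, y, by simpa using ⟨hy, hyt⟩, hxy⟩
  split_ifs with hb hd hd <;> grind

/-- If the fibres of `f : S → T` have at most `k` elements, and at most one outside `B`, then
`|S| ≤ |T| + k |B|`. -/
theorem ncard_le_of_fibers {X Y : Type*} {S : Set X} {T B : Set Y} (hS : S.Finite)
    (hT : T.Finite) (f : X → Y) (hf : Set.MapsTo f S T) (hB : B ⊆ T) (k : ℕ)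
    (hk : ∀ t, {x ∈ S | f x = t}.ncard ≤ k)
    (hB2 : ∀ x ∈ S, ∀ y ∈ S, x ≠ y → f x = f y → f x ∈ B) :
    S.ncard ≤ T.ncard + k * B.ncard := by
  classical
  lift S to Finset X using hS
  lift T to Finset Y using hT
  lift B to Finset Y using T.finite_toSet.subset hB
  simp only [Set.ncard_coe_finset]
  have hcard (Z : Finset Y) (hZ : (Z : Set Y) ⊆ T) :
      Z.card = ∑ t ∈ T, if t ∈ Z then 1 else 0 := by
    rw [Finset.sum_ite_mem, Finset.inter_eq_right.2 (by exact_mod_cast hZ)]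
    simp
  rw [Finset.card_eq_sum_card_fiberwise hf, hcard B hB, Finset.card_eq_sum_ones T,
    Finset.mul_sum, ← Finset.sum_add_distrib]
  refine Finset.sum_le_sum fun t ht => ?_
  have hkt : (S.filter fun x => f x = t).card ≤ k := by
    have h := hk t
    rwa [show {x | x ∈ (S : Set X) ∧ f x = t} = ((S.filter fun x => f x = t : Finset X) : Set X) by
      ext; simp, Set.ncard_coe_finset] at h
  split_ifs with hb
  · omega
  · have : (S.filter fun x => f x = t).card ≤ 1 := by
      refine Finset.card_le_one.2 fun x hx y hy => ?_
      simp only [Finset.mem_filter] at hx hy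
      by_contra hne
      exact hb (hx.2 ▸ hB2 x hx.1 y hy.1 hne (hx.2.trans hy.2.symm))
    omega

end Counting

/-- The left special words of length `n`. -/
def leftSpecial (L : Set (List A)) (n : ℕ) : Set (List A) :=
  {w | w.length = n ∧ ∃ a b, a ≠ b ∧ a :: w ∈ L ∧ b :: w ∈ L}

/-- The right special words of length `n`. -/
def rightSpecial (L : Set (List A)) (n : ℕ) : Set (List A) :=
  {w | w.length = n ∧ ∃ a b, a ≠ b ∧ w ++ [a] ∈ L ∧ w ++ [b] ∈ L}

/-- The words of length in `[m, n)` having two right special left extensions. -/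
def branching (L : Set (List A)) (m n : ℕ) : Set (List A) :=
  {w | m ≤ w.length ∧ w.length < n ∧ ∃ a b, a ≠ b ∧
    a :: w ∈ rightSpecial L (w.length + 1) ∧ b :: w ∈ rightSpecial L (w.length + 1)}

theorem cplx_eq_ncard (L : Set (List A)) (n : ℕ) : cplx L n = (Ln L n).ncard := rfl

theorem eL_eq_ncard (L : Set (List A)) (n : ℕ) :
    eL L n = {w | w ∈ Ln L n ∧ ¬ LeftProlongable L w}.ncard := rfl

theorem eR_eq_ncard (L : Set (List A)) (n : ℕ) :
    eR L n = {w | w ∈ Ln L n ∧ ¬ RightProlongable L w}.ncard := rfl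

section Finiteness

variable [Fintype A]

theorem finite_Ln (L : Set (List A)) (n : ℕ) : (Ln L n).Finite :=
  (List.finite_length_eq A n).subset fun _ h => h.2

theorem finite_leftSpecial (L : Set (List A)) (n : ℕ) : (leftSpecial L n).Finite :=
  (List.finite_length_eq A n).subset fun _ h => h.1

theorem finite_rightSpecial (L : Set (List A)) (n : ℕ) : (rightSpecial L n).Finite :=
  (List.finite_length_eq A n).subset fun _ h => h.1

theorem finite_branching (L : Set (List A)) (m n : ℕ) : (branching L m n).Finite :=
  (List.finite_length_lt A n).subset fun _ h => h.2.1

end Finiteness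

section Factorial

variable {L : Set (List A)}

theorem IsFactorial.of_append_left (hfac : IsFactorial L) {u v : List A} (h : u ++ v ∈ L) :
    u ∈ L := hfac _ _ h (List.prefix_append u v).isInfix

theorem IsFactorial.of_append_right (hfac : IsFactorial L) {u v : List A} (h : u ++ v ∈ L) :
    v ∈ L := hfac _ _ h (List.suffix_append u v).isInfix

theorem IsFactorial.of_cons (hfac : IsFactorial L) {a : A} {v : List A} (h : a :: v ∈ L) :
    v ∈ L := hfac _ _ h (List.suffix_cons a v).isInfix

theorem mapsTo_dropLast (hfac : IsFactorial L) (n : ℕ) :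
    Set.MapsTo List.dropLast (Ln L (n + 1)) (Ln L n) := fun w ⟨hw, hl⟩ =>
  ⟨hfac _ _ hw (List.dropLast_prefix w).isInfix, by simp [hl]⟩

theorem rightSpecial_subset (hfac : IsFactorial L) (n : ℕ) : rightSpecial L n ⊆ Ln L n := by
  rintro w ⟨hl, a, b, -, ha, -⟩
  exact ⟨hfac.of_append_left ha, hl⟩

theorem rightSpecial_of_cons (hfac : IsFactorial L) {n : ℕ} {a : A} {w : List A}
    (h : a :: w ∈ rightSpecial L (n + 1)) : w ∈ rightSpecial L n := by
  obtain ⟨hl, c, d, hcd, hc, hd⟩ := h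
  exact ⟨by simpa using hl, c, d, hcd, hfac.of_cons hc, hfac.of_cons hd⟩

variable [Fintype A]

theorem cplx_add_leftSpecial_le (hfac : IsFactorial L) (n : ℕ) :
    cplx L n + (leftSpecial L n).ncard ≤ cplx L (n + 1) + eL L n := by
  rw [cplx_eq_ncard, cplx_eq_ncard, eL_eq_ncard]
  refine ncard_add_le_of_fibers (finite_Ln L _) (finite_Ln L _) List.tail ?_ ?_ ?_
    (fun w hw => hw.1) ?_
  · rintro (_ | ⟨a, w⟩) ⟨hw, hl⟩
    · simp at hl
    · exact ⟨hfac.of_cons hw, by simpa using hl⟩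
  · rintro w ⟨hl, a, b, -, ha, -⟩
    exact ⟨hfac.of_cons ha, hl⟩
  · rintro w ⟨hl, a, b, hab, ha, hb⟩
    exact ⟨a :: w, ⟨ha, by simpa⟩, b :: w, ⟨hb, by simpa⟩, by simpa, rfl, rfl⟩
  · intro w hw hD
    obtain ⟨a, ha⟩ := not_not.1 fun h => hD ⟨hw, h⟩
    exact ⟨a :: w, ⟨ha, by simp [hw.2]⟩, rfl⟩

theorem cplx_add_rightSpecial_le (hfac : IsFactorial L) (n : ℕ) :
    cplx L n + (rightSpecial L n).ncard ≤ cplx L (n + 1) + eR L n := by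
  rw [cplx_eq_ncard, cplx_eq_ncard, eR_eq_ncard]
  refine ncard_add_le_of_fibers (finite_Ln L _) (finite_Ln L _) List.dropLast
    (mapsTo_dropLast hfac n) (rightSpecial_subset hfac n) ?_ (fun w hw => hw.1) ?_
  · rintro w ⟨hl, a, b, hab, ha, hb⟩
    exact ⟨w ++ [a], ⟨ha, by simpa⟩, w ++ [b], ⟨hb, by simpa⟩, by simpa, by simp, by simp⟩
  · intro w hw hD
    obtain ⟨a, ha⟩ := not_not.1 fun h => hD ⟨hw, h⟩
    exact ⟨w ++ [a], ⟨ha, by simp [hw.2]⟩, by simp⟩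

theorem cplx_succ_le (hfac : IsFactorial L) (n : ℕ) :
    cplx L (n + 1) ≤ cplx L n + Fintype.card A * (rightSpecial L n).ncard := by
  rw [cplx_eq_ncard, cplx_eq_ncard]
  have hdec : ∀ w ∈ Ln L (n + 1), ∃ a, w = w.dropLast ++ [a] := fun w hw =>
    ⟨w.getLast (by rintro rfl; simpa using hw.2), (List.dropLast_append_getLast _).symm⟩
  refine ncard_le_of_fibers (finite_Ln L _) (finite_Ln L _) List.dropLast
    (mapsTo_dropLast hfac n) (rightSpecial_subset hfac n) _ (fun t => ?_) ?_
  · have hsub : {x ∈ Ln L (n + 1) | x.dropLast = t} ⊆ Set.range fun a : A => t ++ [a] := by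
      rintro w ⟨hw, rfl⟩
      obtain ⟨a, ha⟩ := hdec w hw
      exact ⟨a, ha.symm⟩
    refine (Set.ncard_le_ncard hsub (Set.finite_range _)).trans ?_
    rw [← Set.image_univ, ← Nat.card_eq_fintype_card, ← Set.ncard_univ]
    exact Set.ncard_image_le Set.finite_univ
  · intro x hx y hy hxy he
    obtain ⟨a, ha⟩ := hdec x hx
    obtain ⟨b, hb⟩ := hdec y hy
    rw [← he] at hb
    refine ⟨(mapsTo_dropLast hfac n hx).2, a, b, ?_, ha ▸ hx.1, hb ▸ hy.1⟩
    rintro rfl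
    exact hxy (ha.trans hb.symm)

theorem rightSpecial_succ_le (hfac : IsFactorial L) (n : ℕ) :
    (rightSpecial L (n + 1)).ncard ≤
      (rightSpecial L n).ncard + Fintype.card A * (branching L n (n + 1)).ncard := by
  refine ncard_le_of_fibers (finite_rightSpecial L _) (finite_rightSpecial L _) List.tail
    ?_ ?_ _ (fun t => ?_) ?_
  · rintro (_ | ⟨a, w⟩) h
    · simpa using h.1
    · exact rightSpecial_of_cons hfac h
  · rintro w ⟨h1, h2, a, b, -, ha, -⟩
    obtain rfl : n = w.length := by omega
    exact rightSpecial_of_cons hfac ha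
  · have hsub : {x ∈ rightSpecial L (n + 1) | x.tail = t} ⊆ Set.range fun a : A => a :: t := by
      rintro (_ | ⟨a, w⟩) ⟨hw, rfl⟩
      · simpa using hw.1
      · exact ⟨a, rfl⟩
    refine (Set.ncard_le_ncard hsub (Set.finite_range _)).trans ?_
    rw [← Set.image_univ, ← Nat.card_eq_fintype_card, ← Set.ncard_univ]
    exact Set.ncard_image_le Set.finite_univ
  · rintro (_ | ⟨a, w⟩) hx (_ | ⟨b, w'⟩) hy hne he
    · exact absurd rfl hne
    · simpa using hx.1
    · simpa using hy.1
    · obtain rfl : w = w' := he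
      obtain rfl : n = w.length := by simpa using hx.1.symm
      exact ⟨le_rfl, Nat.lt_succ_self _, a, b, by simpa using hne, hx, hy⟩

theorem rightSpecial_le_add_branching (hfac : IsFactorial L) {m n : ℕ} (hmn : m ≤ n) :
    (rightSpecial L n).ncard ≤
      (rightSpecial L m).ncard + Fintype.card A * (branching L m n).ncard := by
  induction n, hmn using Nat.le_induction with
  | base => omega
  | succ n hmn ih =>
    have hun : branching L m (n + 1) = branching L m n ∪ branching L n (n + 1) := by
      ext w
      constructor
      · rintro ⟨h1, h2, h⟩
        rcases Nat.lt_or_ge w.length n with h3 | h3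
        · exact Or.inl ⟨h1, h3, h⟩
        · exact Or.inr ⟨h3, h2, h⟩
      · rintro (⟨h1, h2, h⟩ | ⟨h1, h2, h⟩)
        · exact ⟨h1, by omega, h⟩
        · exact ⟨by omega, h2, h⟩
    have hdisj : Disjoint (branching L m n) (branching L n (n + 1)) :=
      Set.disjoint_left.2 fun w h h' => by have := h.2.1; have := h'.1; omega
    rw [hun, Set.ncard_union_eq hdisj (finite_branching L _ _) (finite_branching L _ _), mul_add]
    have := rightSpecial_succ_le hfac n
    omega

end Factorial

section Periods

/-- All small periods of `u` predict the same letter just before `u`. -/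
theorem exists_letter_before (u : List A) (Δ : ℕ) (hΔ : 2 * Δ ≤ u.length) :
    ∃ o : Option A, ∀ p, 1 ≤ p → p ≤ Δ → (∀ i, i + p < u.length → u[i]? = u[i + p]?) →
      u[p - 1]? = o := by
  by_cases h : ∃ q, 1 ≤ q ∧ q ≤ Δ ∧ ∀ i, i + q < u.length → u[i]? = u[i + q]?
  · obtain ⟨q, hq1, hq, hper⟩ := h
    refine ⟨u[q - 1]?, fun p hp1 hp hper' => ?_⟩
    rw [hper (p - 1) (by omega), hper' (q - 1) (by omega)]
    congr 1
    omega
  · exact ⟨none, fun p hp1 hp hper => (h ⟨p, hp1, hp, hper⟩).elim⟩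

/-- All small periods of `v` predict the same letter just after `v`. -/
theorem exists_letter_after (v : List A) (Δ : ℕ) (hΔ : 2 * Δ ≤ v.length) :
    ∃ o : Option A, ∀ p, 1 ≤ p → p ≤ Δ → (∀ i, i + p < v.length → v[i]? = v[i + p]?) →
      v[v.length - p]? = o := by
  by_cases h : ∃ q, 1 ≤ q ∧ q ≤ Δ ∧ ∀ i, i + q < v.length → v[i]? = v[i + q]?
  · obtain ⟨q, hq1, hq, hper⟩ := h
    refine ⟨v[v.length - q]?, fun p hp1 hp hper' => ?_⟩
    have h1 := hper (v.length - p - q) (by omega)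
    have h2 := hper' (v.length - p - q) (by omega)
    rw [show v.length - p - q + q = v.length - p by omega] at h1
    rw [show v.length - p - q + p = v.length - q by omega] at h2
    rw [← h1, h2]
  · exact ⟨none, fun p hp1 hp hper => (h ⟨p, hp1, hp, hper⟩).elim⟩

/-- Two occurrences of `v` in `W`, the first being followed by a letter not predicted by the small
periods of `v`, cannot be close to each other. -/
theorem not_lt_of_occurrences {W v : List A} {Δ e e' : ℕ} {o : Option A} {c : A}
    (ho : ∀ p, 1 ≤ p → p ≤ Δ → (∀ i, i + p < v.length → v[i]? = v[i + p]?) →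
      v[v.length - p]? = o) (hΔ : Δ ≤ v.length)
    (hv : ∀ i < v.length, W[e + i]? = v[i]?) (hv' : ∀ i < v.length, W[e' + i]? = v[i]?)
    (hc : W[e + v.length]? = some c) (hco : some c ≠ o) (hle : e' ≤ e + Δ) : ¬ e < e' := by
  intro hlt
  refine hco ?_
  rw [← ho (e' - e) (by omega) (by omega) fun i hi => ?_, ← hc, ← hv' _ (by omega)]
  · congr 1
    omega
  · rw [← hv' i (by omega), ← hv (i + (e' - e)) hi]
    congr 1
    omega

/-- Two occurrences of `u` in `W`, the second being preceded by a letter not predicted by the small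
periods of `u`, cannot be close to each other. -/
theorem not_lt_of_occurrences' {W u : List A} {Δ j j' : ℕ} {o : Option A} {a : A}
    (ho : ∀ p, 1 ≤ p → p ≤ Δ → (∀ i, i + p < u.length → u[i]? = u[i + p]?) → u[p - 1]? = o)
    (hΔ : Δ ≤ u.length)
    (hu : ∀ i < u.length, W[j + 1 + i]? = u[i]?) (hu' : ∀ i < u.length, W[j' + 1 + i]? = u[i]?)
    (ha : W[j']? = some a) (hao : some a ≠ o) (hle : j' ≤ j + Δ) : ¬ j < j' := by
  intro hlt
  refine hao ?_
  rw [← ho (j' - j) (by omega) (by omega) fun i hi => ?_, ← ha, ← hu _ (by omega)]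
  · congr 1
    omega
  · rw [← hu' i (by omega), ← hu (i + (j' - j)) hi]
    congr 1
    omega

/-- A word that is not much longer than `u` and `v` contains at most one occurrence of a factor
`a w c` with `w` starting with `u` and ending with `v`, and with `a` and `c` not predicted by the
small periods of `u` and `v`. -/
theorem occurrence_unique {u v : List A} {m Δ : ℕ} (hum : u.length = m) (hvm : v.length = m)
    (hΔ : Δ ≤ m) {o₁ o₂ : Option A}
    (ho₁ : ∀ p, 1 ≤ p → p ≤ Δ → (∀ i, i + p < u.length → u[i]? = u[i + p]?) → u[p - 1]? = o₁)
    (ho₂ : ∀ p, 1 ≤ p → p ≤ Δ → (∀ i, i + p < v.length → v[i]? = v[i + p]?) →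
      v[v.length - p]? = o₂)
    {x w z x' w' z' : List A} {a c a' c' : A}
    (hW : x ++ a :: (w ++ c :: z) = x' ++ a' :: (w' ++ c' :: z'))
    (hlen : (x ++ a :: (w ++ c :: z)).length ≤ m + Δ)
    (hu : u <+: w) (hv : v <:+ w) (hu' : u <+: w') (hv' : v <:+ w')
    (ha : some a ≠ o₁) (hc : some c ≠ o₂) (ha' : some a' ≠ o₁) (hc' : some c' ≠ o₂) :
    x.length = x'.length ∧ w = w' := by
  have key : ∀ {x w z : List A} {a c : A}, u <+: w → v <:+ w →
      (∀ i < u.length, (x ++ a :: (w ++ c :: z))[x.length + 1 + i]? = u[i]?) ∧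
      (∀ i < v.length, (x ++ a :: (w ++ c :: z))[x.length + 1 + (w.length - m) + i]? = v[i]?) ∧
      (x ++ a :: (w ++ c :: z))[x.length]? = some a ∧
      (x ++ a :: (w ++ c :: z))[x.length + 1 + (w.length - m) + v.length]? = some c ∧
      m ≤ w.length := by
    rintro x w z a c ⟨s, rfl⟩ ⟨t, ht⟩
    have hl := congrArg List.length ht
    simp only [List.length_append] at hl
    refine ⟨fun i hi => ?_, fun i hi => ?_, by simp, ?_, by simp; omega⟩
    · rw [List.getElem?_append_right (by omega),
        show x.length + 1 + i - x.length = i + 1 by omega, List.getElem?_cons_succ,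
        List.append_assoc, List.getElem?_append_left hi]
    · rw [← ht, List.getElem?_append_right (by omega), List.length_append,
        show x.length + 1 + (t.length + v.length - m) + i - x.length = t.length + i + 1 by omega,
        List.getElem?_cons_succ, List.append_assoc, List.getElem?_append_right (by omega),
        Nat.add_sub_cancel_left, List.getElem?_append_left hi]
    · rw [← ht, List.getElem?_append_right (by omega), List.length_append,
        show x.length + 1 + (t.length + v.length - m) + v.length - x.length
          = (t ++ v).length + 1 by simp; omega,
        List.getElem?_cons_succ, List.getElem?_append_right le_rfl]
      simp
  obtain ⟨k1, k2, k3, k4, k5⟩ := key (x := x) (z := z) (a := a) (c := c) hu hv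
  obtain ⟨l1, l2, l3, l4, l5⟩ := key (x := x') (z := z') (a := a') (c := c') hu' hv'
  have hlen' := hlen
  rw [hW] at hlen'
  rw [← hW] at l1 l2 l3 l4
  simp only [List.length_append, List.length_cons] at hlen hlen'
  have e1 := not_lt_of_occurrences ho₂ (by omega) k2 l2 k4 hc (by omega)
  have e2 := not_lt_of_occurrences ho₂ (by omega) l2 k2 l4 hc' (by omega)
  have e3 := not_lt_of_occurrences' ho₁ (by omega) k1 l1 l3 ha' (by omega)
  have e4 := not_lt_of_occurrences' ho₁ (by omega) l1 k1 k3 ha (by omega)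
  have hxx : x.length = x'.length := by omega
  have hr := (List.append_inj hW hxx).2
  exact ⟨hxx, (List.append_inj (List.cons.inj hr).2 (by omega)).1⟩

end Periods

section Prolongation

variable {L : Set (List A)}

theorem exists_append_of_not_leftProlongable (hfac : IsFactorial L) {N : ℕ}
    (hN : ∀ w ∈ L, N ≤ w.length → LeftProlongable L w ∨ RightProlongable L w) {w : List A}
    (hw : w ∈ L) (hl : N ≤ w.length) (hnl : ¬ LeftProlongable L w) (d : ℕ) :
    ∃ z, z.length = d ∧ w ++ z ∈ L ∧ ¬ LeftProlongable L (w ++ z) := by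
  induction d with
  | zero => exact ⟨[], by simpa using ⟨hw, hnl⟩⟩
  | succ d ih =>
    obtain ⟨z, hz, hzL, hznl⟩ := ih
    obtain ⟨b, hb⟩ := (hN _ hzL (by simp; omega)).resolve_left hznl
    refine ⟨z ++ [b], by simp [hz], by simpa using hb, ?_⟩
    rintro ⟨a, ha⟩
    exact hznl ⟨a, hfac.of_append_left (v := [b]) (by simpa using ha)⟩

theorem exists_append_of_not_rightProlongable (hfac : IsFactorial L) {N : ℕ}
    (hN : ∀ w ∈ L, N ≤ w.length → LeftProlongable L w ∨ RightProlongable L w) {w : List A}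
    (hw : w ∈ L) (hl : N ≤ w.length) (hnr : ¬ RightProlongable L w) (d : ℕ) :
    ∃ z, z.length = d ∧ z ++ w ∈ L ∧ ¬ RightProlongable L (z ++ w) := by
  induction d with
  | zero => exact ⟨[], by simpa using ⟨hw, hnr⟩⟩
  | succ d ih =>
    obtain ⟨z, hz, hzL, hznr⟩ := ih
    obtain ⟨b, hb⟩ := (hN _ hzL (by simp; omega)).resolve_right hznr
    refine ⟨b :: z, by simp [hz], by simpa using hb, ?_⟩
    rintro ⟨a, ha⟩
    exact hznr ⟨a, hfac.of_cons (a := b) (by simpa using ha)⟩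

theorem exists_append_left_or (L : Set (List A)) {w : List A} (hw : w ∈ L) (d : ℕ) :
    ∃ z, z.length ≤ d ∧ z ++ w ∈ L ∧ (z.length = d ∨ ¬ LeftProlongable L (z ++ w)) := by
  induction d with
  | zero => exact ⟨[], by simp [hw]⟩
  | succ d ih =>
    obtain ⟨z, hz, hzL, h⟩ := ih
    by_cases hp : LeftProlongable L (z ++ w)
    · obtain ⟨a, ha⟩ := hp
      refine ⟨a :: z, by simpa using hz, by simpa using ha, Or.inl ?_⟩
      simpa using h.resolve_right (not_not.2 ⟨a, ha⟩)
    · exact ⟨z, by omega, hzL, Or.inr hp⟩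

theorem exists_append_right_or (L : Set (List A)) {w : List A} (hw : w ∈ L) (d : ℕ) :
    ∃ z, z.length ≤ d ∧ w ++ z ∈ L ∧ (z.length = d ∨ ¬ RightProlongable L (w ++ z)) := by
  induction d with
  | zero => exact ⟨[], by simp [hw]⟩
  | succ d ih =>
    obtain ⟨z, hz, hzL, h⟩ := ih
    by_cases hp : RightProlongable L (w ++ z)
    · obtain ⟨a, ha⟩ := hp
      refine ⟨z ++ [a], by simpa using hz, by simpa using ha, Or.inl ?_⟩
      simpa using h.resolve_right (not_not.2 ⟨a, ha⟩)
    · exact ⟨z, by omega, hzL, Or.inr hp⟩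

/-- A long enough word extends to a word of length `M` that has `T` letters on the left, or is not
left-prolongable, or is not right-prolongable. -/
theorem exists_extension (hfac : IsFactorial L) {N : ℕ}
    (hN : ∀ w ∈ L, N ≤ w.length → LeftProlongable L w ∨ RightProlongable L w) {w : List A}
    (hw : w ∈ L) (hl : N ≤ w.length) {T M : ℕ} (hM : w.length + T ≤ M) :
    ∃ x z, x ++ w ++ z ∈ Ln L M ∧ (x.length = T ∨ ¬ LeftProlongable L (x ++ w ++ z) ∨
      ¬ RightProlongable L (x ++ w ++ z)) := by
  obtain ⟨x, hx, hxL, h⟩ := exists_append_left_or L hw T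
  by_cases hp : LeftProlongable L (x ++ w)
  · have hxT := h.resolve_right (not_not.2 hp)
    obtain ⟨z, hz, hzL, h'⟩ := exists_append_right_or L hxL (M - w.length - T)
    by_cases hr : RightProlongable L (x ++ w ++ z)
    · have hzT := h'.resolve_right (not_not.2 hr)
      exact ⟨x, z, ⟨hzL, by simp; omega⟩, Or.inl hxT⟩
    · obtain ⟨y, hy, hyL, hyr⟩ := exists_append_of_not_rightProlongable hfac hN hzL
        (by simp; omega) hr (M - (x ++ w ++ z).length)
      simp only [List.length_append] at hy
      refine ⟨y ++ x, z, ⟨by simpa using hyL, by simp; omega⟩, Or.inr (Or.inr ?_)⟩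
      simpa using hyr
  · obtain ⟨z, hz, hzL, hznl⟩ := exists_append_of_not_leftProlongable hfac hN hxL
      (by simp; omega) hp (M - (x ++ w).length)
    simp only [List.length_append] at hz
    exact ⟨x, z, ⟨hzL, by simp; omega⟩, Or.inr (Or.inl hznl)⟩

end Prolongation

section Branching

variable {L : Set (List A)}

theorem exists_letters_of_mem_branching {m n : ℕ} {w : List A} (hw : w ∈ branching L m n)
    (o₁ o₂ : Option A) : ∃ a c, some a ≠ o₁ ∧ some c ≠ o₂ ∧ a :: (w ++ [c]) ∈ L := by
  obtain ⟨-, -, a, b, hab, ha, hb⟩ := hw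
  obtain ⟨a, hao, ha⟩ : ∃ a, some a ≠ o₁ ∧ a :: w ∈ rightSpecial L (w.length + 1) := by
    by_cases h : some a = o₁
    · exact ⟨b, fun h' => hab (Option.some.inj (h.trans h'.symm)), hb⟩
    · exact ⟨a, h, ha⟩
  obtain ⟨-, c, d, hcd, hc, hd⟩ := ha
  by_cases h : some c = o₂
  · exact ⟨a, d, hao, fun h' => hcd (Option.some.inj (h.trans h'.symm)), hd⟩
  · exact ⟨a, c, hao, h, hc⟩

variable [Fintype A]

/-- The number of branching words with a given prefix `u` and suffix `v`. -/
theorem branching_prefix_suffix_le (hfac : IsFactorial L) {N m n T : ℕ}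
    (hN : ∀ w ∈ L, N ≤ w.length → LeftProlongable L w ∨ RightProlongable L w) (hNm : N ≤ m)
    (hm : 2 * (n + 1 + 2 * T - m) ≤ m) {u v : List A} (hu : u.length = m) (hv : v.length = m) :
    {w ∈ branching L m n | u <+: w ∧ v <:+ w}.ncard * (T + 1) ≤
      cplx L (n + 1 + T) + (eL L (n + 1 + 2 * T) + eR L (n + 1 + 2 * T)) * (T + 1) := by
  classical
  set Δ := n + 1 + 2 * T - m with hΔ
  obtain ⟨o₁, ho₁⟩ := exists_letter_before u Δ (by omega)
  obtain ⟨o₂, ho₂⟩ := exists_letter_after v Δ (by omega)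
  set S := {w ∈ branching L m n | u <+: w ∧ v <:+ w} with hS
  have hSfin : S.Finite := (finite_branching L m n).subset fun _ h => h.1
  have hex : ∀ w : S, ∃ a c x z, some a ≠ o₁ ∧ some c ≠ o₂ ∧
      x ++ a :: (w.1 ++ c :: z) ∈ Ln L (n + 1 + 2 * T) ∧
      (x.length = T ∨ ¬ LeftProlongable L (x ++ a :: (w.1 ++ c :: z)) ∨
        ¬ RightProlongable L (x ++ a :: (w.1 ++ c :: z))) := by
    rintro ⟨w, hw⟩
    obtain ⟨a, c, ha, hc, hL⟩ := exists_letters_of_mem_branching hw.1 o₁ o₂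
    have h1 := hw.1.1
    have h2 := hw.1.2.1
    obtain ⟨x, z, h, h'⟩ := exists_extension hfac hN hL (by simp; omega) (T := T)
      (M := n + 1 + 2 * T) (by simp; omega)
    exact ⟨a, c, x, z, ha, hc, by simpa using h, by simpa using h'⟩
  choose a c x z ha hc hW hor using hex
  have huniq : ∀ (w w' : S) (y y' t t' : List A),
      y ++ a w :: (w.1 ++ c w :: t) = y' ++ a w' :: (w'.1 ++ c w' :: t') →
      (y ++ a w :: (w.1 ++ c w :: t)).length ≤ n + 1 + 2 * T → y.length = y'.length ∧ w = w' := by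
    intro w w' y y' t t' heq hlen
    have := occurrence_unique hu hv (by omega : Δ ≤ m) ho₁ ho₂ heq (by omega) w.2.2.1 w.2.2.2
      w'.2.2.1 w'.2.2.2 (ha w) (hc w) (ha w') (hc w')
    exact ⟨this.1, Subtype.ext this.2⟩
  have : Finite S := hSfin
  let F : S → List A := fun w => x w ++ a w :: (w.1 ++ c w :: z w)
  have hFinj : Function.Injective F := fun w w' h =>
    (huniq w w' _ _ _ _ h (hW w).2.le).2
  let S₁ : Set S := {w | (x w).length = T}
  let S₂ : Set S := {w | ¬ LeftProlongable L (F w)}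
  let S₃ : Set S := {w | ¬ RightProlongable L (F w)}
  have hcover : S.ncard ≤ S₁.ncard + S₂.ncard + S₃.ncard := by
    have huniv : (Set.univ : Set S) = S₁ ∪ S₂ ∪ S₃ := by
      refine (Set.eq_univ_of_forall fun w => ?_).symm
      rcases hor w with h | h | h
      · exact Or.inl (Or.inl h)
      · exact Or.inl (Or.inr h)
      · exact Or.inr h
    have h1 := Set.ncard_union_le (S₁ ∪ S₂) S₃
    have h2 := Set.ncard_union_le S₁ S₂
    rw [← huniv, Set.ncard_univ, Nat.card_coe_set_eq] at h1
    omega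
  have h2 : S₂.ncard ≤ eL L (n + 1 + 2 * T) :=
    Set.ncard_le_ncard_of_injOn F (fun w hw => ⟨hW w, hw⟩) hFinj.injOn
      ((finite_Ln L _).subset fun _ h => h.1)
  have h3 : S₃.ncard ≤ eR L (n + 1 + 2 * T) :=
    Set.ncard_le_ncard_of_injOn F (fun w hw => ⟨hW w, hw⟩) hFinj.injOn
      ((finite_Ln L _).subset fun _ h => h.1)
  have h1 : S₁.ncard * (T + 1) ≤ cplx L (n + 1 + T) := by
    have hcut : ∀ w ∈ S₁, ∀ d ≤ T, ∃ t, (x w).drop d ++ a w :: (w.1 ++ c w :: t) ∈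
        Ln L (n + 1 + T) := by
      intro w hw d hd
      have hxT : (x w).length = T := hw
      have hlt := w.2.1.2.1
      have hlenW := (hW w).2
      simp only [List.length_append, List.length_cons] at hlenW
      refine ⟨(z w).take (n + d - 1 - w.1.length), hfac _ _ (hW w).1 ?_, ?_⟩
      · refine ⟨(x w).take d, (z w).drop (n + d - 1 - w.1.length), ?_⟩
        simp only [List.append_assoc, List.cons_append, List.take_append_drop]
        rw [← List.append_assoc, List.take_append_drop]
      · simp only [List.length_append, List.length_cons, List.length_drop, List.length_take]
        omega
    choose! t ht using hcut
    have hprod : (S₁ ×ˢ (Finset.range (T + 1) : Set ℕ)).ncard = S₁.ncard * (T + 1) := by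
      rw [Set.ncard_prod, Set.ncard_coe_finset, Finset.card_range]
    rw [← hprod]
    refine Set.ncard_le_ncard_of_injOn
      (fun q => (x q.1).drop q.2 ++ a q.1 :: (q.1.1 ++ c q.1 :: t q.1 q.2)) ?_ ?_ (finite_Ln L _)
    · rintro ⟨w, d⟩ ⟨hw, hd⟩
      exact ht w hw d (by simpa [Nat.lt_succ_iff] using hd)
    · rintro ⟨w, d⟩ ⟨hw, hd⟩ ⟨w', d'⟩ ⟨hw', hd'⟩ heq
      have hd : d ≤ T := by simpa [Nat.lt_succ_iff] using hd
      have hd' : d' ≤ T := by simpa [Nat.lt_succ_iff] using hd'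
      obtain ⟨hl, rfl⟩ := huniq w w' _ _ _ _ heq (by rw [(ht w hw d hd).2]; omega)
      have hxT : (x w).length = T := hw
      simp only [List.length_drop, hxT] at hl
      obtain rfl : d = d' := by omega
      rfl
  calc S.ncard * (T + 1) ≤ (S₁.ncard + S₂.ncard + S₃.ncard) * (T + 1) :=
        Nat.mul_le_mul_right _ hcover
    _ = S₁.ncard * (T + 1) + (S₂.ncard + S₃.ncard) * (T + 1) := by ring
    _ ≤ _ := Nat.add_le_add h1 (Nat.mul_le_mul_right _ (Nat.add_le_add h2 h3))

theorem branching_le (hfac : IsFactorial L) {N m n T : ℕ}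
    (hN : ∀ w ∈ L, N ≤ w.length → LeftProlongable L w ∨ RightProlongable L w) (hNm : N ≤ m)
    (hm : 2 * (n + 1 + 2 * T - m) ≤ m) :
    (branching L m n).ncard * (T + 1) ≤ (leftSpecial L m).ncard * (rightSpecial L m).ncard *
      (cplx L (n + 1 + T) + (eL L (n + 1 + 2 * T) + eR L (n + 1 + 2 * T)) * (T + 1)) := by
  classical
  set P := ((finite_leftSpecial L m).toFinset ×ˢ (finite_rightSpecial L m).toFinset) with hP
  have hsub : branching L m n ⊆
      ⋃ q ∈ P, {w ∈ branching L m n | q.1 <+: w ∧ q.2 <:+ w} := by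
    intro w hw
    have hwm := hw.1
    obtain ⟨-, -, a, b, hab, ha, hb⟩ := id hw
    have hl : w.take m ∈ leftSpecial L m := by
      refine ⟨by simpa using hwm, a, b, hab, ?_, ?_⟩
      · obtain ⟨-, c, d, -, hc, -⟩ := ha
        exact hfac _ _ (hfac.of_append_left hc) ((List.take_prefix (m + 1) (a :: w)).isInfix)
      · obtain ⟨-, c, d, -, hc, -⟩ := hb
        exact hfac _ _ (hfac.of_append_left hc) ((List.take_prefix (m + 1) (b :: w)).isInfix)
    have hr : w.drop (w.length - m) ∈ rightSpecial L m := by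
      obtain ⟨-, c, d, hcd, hc, hd⟩ := rightSpecial_of_cons hfac ha
      have hlift : ∀ c, w ++ [c] ∈ L → w.drop (w.length - m) ++ [c] ∈ L := fun c hc => by
        rw [← List.take_append_drop (w.length - m) w, List.append_assoc] at hc
        exact hfac.of_append_right hc
      exact ⟨by simp; omega, c, d, hcd, hlift c hc, hlift d hd⟩
    simp only [Set.mem_iUnion]
    exact ⟨(w.take m, w.drop (w.length - m)), by simp [hP, hl, hr], hw, List.take_prefix _ _,
      List.drop_suffix _ _⟩
  have hcard : (branching L m n).ncard ≤
      ∑ q ∈ P, {w ∈ branching L m n | q.1 <+: w ∧ q.2 <:+ w}.ncard :=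
    (Set.ncard_le_ncard hsub (P.finite_toSet.biUnion fun _ _ => (finite_branching L m n).subset fun _ h => h.1)).trans
      (Finset.set_ncard_biUnion_le _ _)
  calc (branching L m n).ncard * (T + 1)
      ≤ ∑ q ∈ P, {w ∈ branching L m n | q.1 <+: w ∧ q.2 <:+ w}.ncard * (T + 1) := by
        rw [← Finset.sum_mul]
        exact Nat.mul_le_mul_right _ hcard
    _ ≤ P.card • _ := Finset.sum_le_card_nsmul _ _ _ fun q hq => by
        simp only [hP, Finset.mem_product, Set.Finite.mem_toFinset] at hq
        exact branching_prefix_suffix_le hfac hN hNm hm hq.1.1 hq.2.1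
    _ = _ := by
        rw [hP, Finset.card_product, ← Set.ncard_eq_toFinset_card _ (finite_leftSpecial L m),
          ← Set.ncard_eq_toFinset_card _ (finite_rightSpecial L m), smul_eq_mul]

end Branching

/-- Some increment of `f : ℕ → ℕ` over an interval of length `T` is at most the average. -/
theorem exists_mul_le_sub (f : ℕ → ℕ) {n T : ℕ} (hT : 0 < T) (hn : T ≤ n) :
    ∃ m, n - T ≤ m ∧ m < n ∧ (T : ℝ) * ((f (m + 1) : ℝ) - f m) ≤ f n := by
  by_contra! h
  have hsum : ∑ i ∈ Finset.Ico (n - T) n, ((f (i + 1) : ℝ) - f i) = f n - f (n - T) :=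
    Finset.sum_Ico_sub (fun i => (f i : ℝ)) (Nat.sub_le _ _)
  have hlt : ∑ i ∈ Finset.Ico (n - T) n, (f n : ℝ) <
      ∑ i ∈ Finset.Ico (n - T) n, (T : ℝ) * ((f (i + 1) : ℝ) - f i) := by
    refine Finset.sum_lt_sum_of_nonempty ⟨n - T, by simp; omega⟩ fun i hi => ?_
    rw [Finset.mem_Ico] at hi
    exact h i hi.1 hi.2
  rw [← Finset.mul_sum, hsum, Finset.sum_const, Nat.card_Ico, nsmul_eq_mul,
    show n - (n - T) = T by omega] at hlt
  have : (0 : ℝ) ≤ T * f (n - T) := by positivity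
  linarith

theorem leftProlongable_or_rightProlongable_of_eBoth_eq_zero [Fintype A] {L : Set (List A)}
    {N₀ : ℕ} (he : ∀ n ≥ N₀, eBoth L n = 0) (w : List A) (hw : w ∈ L) (hl : N₀ ≤ w.length) :
    LeftProlongable L w ∨ RightProlongable L w := by
  by_contra! h
  have hfin : {v : List A | v ∈ Ln L w.length ∧ ¬ LeftProlongable L v ∧
      ¬ RightProlongable L v}.Finite := (finite_Ln L _).subset fun _ h => h.1
  have h0 : {v : List A | v ∈ Ln L w.length ∧ ¬ LeftProlongable L v ∧
      ¬ RightProlongable L v}.ncard = 0 := he _ hl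
  rw [Set.ncard_eq_zero hfin] at h0
  exact (h0.subset ⟨⟨hw, rfl⟩, h⟩ : w ∈ (∅ : Set (List A)))

theorem complexity_difference_bigO {A : Type*} [Fintype A]
    (L : Set (List A)) (hfac : IsFactorial L) (hap : AlmostProlongable L)
    (hunb : ∀ M : ℕ, ∃ n : ℕ, M < cplx L n)
    (N₀ : ℕ) (he : ∀ n ≥ N₀, eBoth L n = 0)
    (α β : ℝ) (hα : α ∈ Set.Icc (0 : ℝ) (1 / 2)) (hβ : β ∈ Set.Icc (1 : ℝ) (3 / 2))
    (hpO : ∃ C : ℝ, ∃ N : ℕ, ∀ n ≥ N, (cplx L n : ℝ) ≤ C * (n : ℝ) ^ β)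
    (helO : ∃ C : ℝ, ∃ N : ℕ, ∀ n ≥ N, (eL L n : ℝ) ≤ C * (n : ℝ) ^ α)
    (herO : ∃ C : ℝ, ∃ N : ℕ, ∀ n ≥ N, (eR L n : ℝ) ≤ C * (n : ℝ) ^ α) :
    ∃ C : ℝ, ∃ N : ℕ, ∀ n ≥ N,
      |(cplx L (n + 1) : ℝ) - (cplx L n : ℝ)| ≤ C * (n : ℝ) ^ (3 * max α (β - 1)) := by
  obtain ⟨C₁, N₁, hp⟩ := hpO
  obtain ⟨C₂, N₂, hel⟩ := helO
  obtain ⟨C₃, N₃, her⟩ := herO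
  set γ := max α (β - 1) with hγ
  have hαγ : α ≤ γ := le_max_left _ _
  have hβγ : β ≤ γ + 1 := by linarith [le_max_right α (β - 1)]
  have hγ0 : 0 ≤ γ := hα.1.trans hαγ
  have hγ1 : γ ≤ 1 := max_le (by linarith [hα.2]) (by linarith [hβ.2])
  obtain ⟨D, hD0, hD1, hD2, hD3⟩ : ∃ D : ℝ, 0 ≤ D ∧ C₁ ≤ D ∧ C₂ ≤ D ∧ C₃ ≤ D :=
    ⟨max 0 (max C₁ (max C₂ C₃)), by simp, by simp, by simp, by simp⟩
  set k := Fintype.card A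
  refine ⟨k * (82 * D + k * (82 ^ 2 * 44 * D ^ 3)) + 2 * D,
    10 + 2 * (N₀ + N₁ + N₂ + N₃), fun n hn => ?_⟩
  have hn0 : (0 : ℝ) ≤ n := n.cast_nonneg
  set X := (n : ℝ) ^ γ with hX
  have hX1 : 1 ≤ X := Real.one_le_rpow (by exact_mod_cast (by omega : 1 ≤ n)) hγ0
  have hpow : ∀ j : ℕ, j ≤ 2 * n → (j : ℝ) ^ γ ≤ 2 * X := fun j hj => by
    calc (j : ℝ) ^ γ ≤ (2 * n : ℝ) ^ γ :=
          Real.rpow_le_rpow j.cast_nonneg (by exact_mod_cast hj) hγ0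
      _ = 2 ^ γ * X := Real.mul_rpow (by norm_num) hn0
      _ ≤ 2 ^ (1 : ℝ) * X := by gcongr; norm_num
      _ = 2 * X := by rw [Real.rpow_one]
  have hcoef : ∀ (c δ : ℝ) (j : ℕ), c ≤ D → δ ≤ γ → 1 ≤ j → j ≤ 2 * n →
      c * (j : ℝ) ^ δ ≤ 2 * D * X := fun c δ j hc hδ hj1 hj => by
    have hj1' : (1 : ℝ) ≤ j := by exact_mod_cast hj1
    calc c * (j : ℝ) ^ δ ≤ D * (j : ℝ) ^ γ := by gcongr
      _ ≤ D * (2 * X) := by gcongr; exact hpow j hj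
      _ = 2 * D * X := by ring
  have hel' : ∀ j, N₂ ≤ j → 1 ≤ j → j ≤ 2 * n → (eL L j : ℝ) ≤ 2 * D * X :=
    fun j hj hj1 hj2 => (hel j hj).trans (hcoef _ _ j hD2 hαγ hj1 hj2)
  have her' : ∀ j, N₃ ≤ j → 1 ≤ j → j ≤ 2 * n → (eR L j : ℝ) ≤ 2 * D * X :=
    fun j hj hj1 hj2 => (her j hj).trans (hcoef _ _ j hD3 hαγ hj1 hj2)
  have hp' : ∀ j, N₁ ≤ j → 1 ≤ j → j ≤ 2 * n → (cplx L j : ℝ) ≤ 4 * D * n * X := by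
    intro j hj hj1 hj2
    have hj0 : (0 : ℝ) < j := by exact_mod_cast hj1
    have hj2' : (j : ℝ) ≤ 2 * n := by exact_mod_cast hj2
    calc (cplx L j : ℝ) ≤ C₁ * (j : ℝ) ^ β := hp j hj
      _ = (C₁ * (j : ℝ) ^ (β - 1)) * j := by
        rw [Real.rpow_sub_one hj0.ne']
        field_simp
      _ ≤ (2 * D * X) * (2 * n) :=
        mul_le_mul (hcoef _ _ j hD1 (by linarith) hj1 hj2) hj2' hj0.le (by positivity)
      _ = 4 * D * n * X := by ring
  set T := n / 10 with hT
  obtain ⟨m, hm1, hm2, hm3⟩ := exists_mul_le_sub (cplx L) (n := n) (T := T) (by omega) (by omega)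
  have hT0 : (0 : ℝ) < T := by exact_mod_cast (by omega : 0 < T)
  have hnT : (n : ℝ) ≤ 20 * T := by exact_mod_cast (by omega : n ≤ 20 * T)
  have hs : (cplx L (m + 1) : ℝ) - cplx L m ≤ 80 * D * X := by
    refine le_of_mul_le_mul_left ?_ hT0
    calc _ ≤ (cplx L n : ℝ) := hm3
      _ ≤ 4 * D * n * X := hp' n (by omega) (by omega) (by omega)
      _ ≤ 4 * D * (20 * T) * X := by gcongr
      _ = T * (80 * D * X) := by ring
  have hLS : ((leftSpecial L m).ncard : ℝ) ≤ 82 * D * X := by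
    have h : (cplx L m : ℝ) + (leftSpecial L m).ncard ≤ cplx L (m + 1) + eL L m := by
      exact_mod_cast cplx_add_leftSpecial_le hfac m
    linarith [hel' m (by omega) (by omega) (by omega)]
  have hRS : ((rightSpecial L m).ncard : ℝ) ≤ 82 * D * X := by
    have h : (cplx L m : ℝ) + (rightSpecial L m).ncard ≤ cplx L (m + 1) + eR L m := by
      exact_mod_cast cplx_add_rightSpecial_le hfac m
    linarith [her' m (by omega) (by omega) (by omega)]
  have hbr : ((branching L m n).ncard : ℝ) ≤ 82 ^ 2 * 44 * D ^ 3 * X ^ 3 := by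
    have h : ((branching L m n).ncard : ℝ) * (T + 1) ≤
        (leftSpecial L m).ncard * (rightSpecial L m).ncard * (cplx L (n + 1 + T) +
          (eL L (n + 1 + 2 * T) + eR L (n + 1 + 2 * T)) * (T + 1)) := by
      exact_mod_cast branching_le hfac (leftProlongable_or_rightProlongable_of_eBoth_eq_zero he)
        (by omega : N₀ ≤ m) (by omega : 2 * (n + 1 + 2 * T - m) ≤ m)
    have hnT' : (n : ℝ) ≤ 10 * (T + 1) := by exact_mod_cast (by omega : n ≤ 10 * (T + 1))
    have h1 := hp' (n + 1 + T) (by omega) (by omega) (by omega)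
    have h2 := hel' (n + 1 + 2 * T) (by omega) (by omega) (by omega)
    have h3 := her' (n + 1 + 2 * T) (by omega) (by omega) (by omega)
    refine le_of_mul_le_mul_right ?_ (by positivity : (0 : ℝ) < T + 1)
    calc _ ≤ _ := h
      _ ≤ (82 * D * X) * (82 * D * X) *
          (4 * D * (10 * (T + 1)) * X + (2 * D * X + 2 * D * X) * (T + 1)) := by
        gcongr
        exact h1.trans (by gcongr)
      _ = _ := by ring
  have hX3 : X ≤ X ^ 3 := le_self_pow₀ hX1 (by norm_num)
  have hRSn : ((rightSpecial L n).ncard : ℝ) ≤ (82 * D + k * (82 ^ 2 * 44 * D ^ 3)) * X ^ 3 := by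
    have h : ((rightSpecial L n).ncard : ℝ) ≤
        (rightSpecial L m).ncard + k * (branching L m n).ncard := by
      exact_mod_cast rightSpecial_le_add_branching hfac hm2.le
    calc _ ≤ _ := h
      _ ≤ 82 * D * X ^ 3 + k * (82 ^ 2 * 44 * D ^ 3 * X ^ 3) := by
        gcongr
        exact hRS.trans (by gcongr)
      _ = _ := by ring
  have hupper : (cplx L (n + 1) : ℝ) ≤ cplx L n + k * (rightSpecial L n).ncard := by
    exact_mod_cast cplx_succ_le hfac n
  have hlower : (cplx L n : ℝ) ≤ cplx L (n + 1) + eL L n := by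
    exact_mod_cast (Nat.le_add_right _ _).trans (cplx_add_leftSpecial_le hfac n)
  have helX : (eL L n : ℝ) ≤ 2 * D * X ^ 3 :=
    (hel' n (by omega) (by omega) (by omega)).trans (by gcongr)
  have hkRS : (k : ℝ) * (rightSpecial L n).ncard ≤
      k * ((82 * D + k * (82 ^ 2 * 44 * D ^ 3)) * X ^ 3) := by gcongr
  have hX3eq : (n : ℝ) ^ (3 * γ) = X ^ 3 := by
    rw [mul_comm, Real.rpow_mul hn0]
    exact_mod_cast Real.rpow_natCast _ 3
  have hk0 : (0 : ℝ) ≤ k * ((82 * D + k * (82 ^ 2 * 44 * D ^ 3)) * X ^ 3) := by positivity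
  have hD0' : 0 ≤ 2 * D * X ^ 3 := by positivity
  rw [hX3eq, add_mul, mul_assoc, abs_le]
  constructor <;> linarith
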